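/- Consider the fiber product model $Z = \{(z^{(1)}, \ldots, z^{(l)}, q) \in \mathbb{C}^{s_1+1} \times \cdots \times \mathbb{C}^{s_l+1} \times \mathbb{C}^2 : z^{(i)}_1 z^{(i)}_2 = z^{(j)}_1 z^{(j)}_2 \text{ for all } i,j\}$ cut out by the equations $z^{(i)}_1 z^{(i)}_2 - z^{(j)}_1 z^{(j)}_2 = 0$. Then $Z$ is singular at any point where $z^{(i)}_1 = z^{(i)}_2 = 0$ for all $i$ and $l \geq 2$. However, the augmented variety $\tilde{Z} = \{(z^{(0)}, z^{(1)}, \ldots, z^{(l)}, q_1, \ldots, q_l) : z^{(0)}_1 z^{(0)}_2 = z^{(i)}_1 z^{(i)}_2 + h_i(q_i) \text{ for all } i\}$, where each $h_i : \mathbb{C}^2 \to \mathbb{C}$ is a submersion at the relevant base point $p_i$ (i.e., $dh_i(p_i) \neq 0$), is a smooth manifold at every point with $q_i = p_i$. -/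

import Mathlib

/-- `S` is a smooth (`C^∞`) submanifold of `E` at the point `x`: near `x`, after a linear
change of coordinates, `S` is the graph of a smooth function. -/
def IsSmoothSubmanifoldAt (E : Type*) [NormedAddCommGroup E] [NormedSpace ℝ E]
    (S : Set E) (x : E) : Prop :=
  ∃ (m k : ℕ) (φ : E ≃L[ℝ] ((Fin m → ℝ) × (Fin k → ℝ))) (g : (Fin m → ℝ) → (Fin k → ℝ)),
    ContDiff ℝ (⊤ : ℕ∞) g ∧ ∃ U ∈ nhds x, ∀ y ∈ U, (y ∈ S ↔ (φ y).2 = g (φ y).1)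

open scoped Topology ContDiff

/-- The germ of an analytic map between finite-dimensional spaces extends to a globally defined
smooth map. -/
theorem exists_contDiff_eventuallyEq_of_contDiffAt {V W : Type*} [NormedAddCommGroup V]
    [NormedSpace ℝ V] [HasContDiffBump V] [NormedAddCommGroup W] [NormedSpace ℝ W] {g : V → W}
    {a : V} (hg : ContDiffAt ℝ ω g a) :
    ∃ g' : V → W, ContDiff ℝ ∞ g' ∧ g' =ᶠ[𝓝 a] g := by
  obtain ⟨r, hr, hball⟩ := Metric.eventually_nhds_iff_ball.1 (hg.eventually (by simp))
  let b : ContDiffBump a := ⟨r / 3, r / 2, by positivity, by linarith⟩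
  refine ⟨fun y => b y • g y, contDiff_iff_contDiffAt.2 fun y => ?_, ?_⟩
  · by_cases hy : y ∈ Metric.ball a r
    · exact b.contDiffAt.smul ((hball y hy).of_le le_top)
    · have hy' : y ∉ tsupport b := by
        rw [b.tsupport_eq, Metric.mem_closedBall]
        rw [Metric.mem_ball] at hy
        change ¬ dist y a ≤ r / 2
        linarith
      refine (contDiffAt_const (c := (0 : W))).congr_of_eventuallyEq ?_
      filter_upwards [notMem_tsupport_iff_eventuallyEq.1 hy'] with z hz
      simp [hz]
  · filter_upwards [b.eventuallyEq_one] with y hy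
    simp [hy]

/-- The zero set of an analytic map between finite-dimensional spaces is a smooth submanifold at
every zero where the derivative is surjective. -/
theorem isSmoothSubmanifoldAt_zeroSet {E G : Type*} [NormedAddCommGroup E] [NormedSpace ℝ E]
    [FiniteDimensional ℝ E] [NormedAddCommGroup G] [NormedSpace ℝ G] [FiniteDimensional ℝ G]
    {F : E → G} {x : E} (hF : ContDiffAt ℝ ω F x) (hx : F x = 0)
    (hsurj : Function.Surjective (fderiv ℝ F x)) :
    IsSmoothSubmanifoldAt E {y | F y = 0} x := by
  have := FiniteDimensional.complete ℝ E
  have := FiniteDimensional.complete ℝ G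
  set A := fderiv ℝ F x with hA
  obtain ⟨B, hB⟩ := (A : E →ₗ[ℝ] G).exists_rightInverse_of_surjective
    (LinearMap.range_eq_top.2 hsurj)
  have hB' : Function.RightInverse (LinearMap.toContinuousLinearMap B) A := fun c =>
    LinearMap.congr_fun hB c
  let e := ContinuousLinearEquiv.equivOfRightInverse A (LinearMap.toContinuousLinearMap B) hB'
  let e₁ : A.ker ≃L[ℝ] (Fin (Module.finrank ℝ A.ker) → ℝ) :=
    ContinuousLinearEquiv.ofFinrankEq (by simp)
  let e₂ : G ≃L[ℝ] (Fin (Module.finrank ℝ G) → ℝ) := ContinuousLinearEquiv.ofFinrankEq (by simp)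
  let φ := (e.trans (ContinuousLinearEquiv.prodComm ℝ G A.ker)).trans (e₁.prodCongr e₂)
  have hf : ContDiffAt ℝ ω (F ∘ φ.symm) (φ x) :=
    ContDiffAt.comp _ (by simpa using hF) φ.symm.contDiff.contDiffAt
  have hinv : (fderiv ℝ (F ∘ φ.symm) (φ x) ∘L .inr ℝ _ _).IsInvertible := by
    refine ⟨e₂.symm, ?_⟩
    rw [φ.symm.comp_right_fderiv]
    ext1 c
    simp only [φ.symm_apply_apply, ← hA]
    simpa [φ, e, ContinuousLinearEquiv.equivOfRightInverse] using (hB' (e₂.symm c)).symm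
  obtain ⟨g, hg, hgeq⟩ := exists_contDiff_eventuallyEq_of_contDiffAt
    (hf.contDiffAt_implicitFunction (by simp) hinv)
  refine ⟨_, _, φ, g, hg, {y | F y = 0 ↔ (φ y).2 = g (φ y).1}, ?_, fun y hy => hy⟩
  have h₁ := φ.continuous.continuousAt.eventually
    (hf.eventually_apply_eq_iff_implicitFunction (by simp) hinv)
  have h₂ := (continuous_fst.comp φ.continuous).continuousAt.eventually hgeq
  filter_upwards [h₁, h₂] with y hy₁ hy₂
  simp only [Function.comp_apply, φ.symm_apply_apply, hx] at hy₁ hy₂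
  rw [hy₁, hy₂, eq_comm]

/-- Let `S` be a smooth submanifold at `x`. If every vector is a sum of two directions along which
the line through `x` is contained in `S`, then `S` is a neighborhood of `x`. -/
theorem IsSmoothSubmanifoldAt.mem_nhds_of_lines {E : Type*} [NormedAddCommGroup E]
    [NormedSpace ℝ E] {S : Set E} {x : E} (hS : IsSmoothSubmanifoldAt E S x)
    (hlines : ∀ w : E, ∃ v v' : E, w = v + v' ∧
      (∀ t : ℝ, x + t • v ∈ S) ∧ ∀ t : ℝ, x + t • v' ∈ S) :
    S ∈ 𝓝 x := by
  obtain ⟨m, k, φ, g, hg, U, hU, hUS⟩ := hS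
  have tangent : ∀ v : E, (∀ t : ℝ, x + t • v ∈ S) →
      (φ v).2 = fderiv ℝ g (φ x).1 (φ v).1 := by
    intro v hv
    have hc : HasDerivAt (fun t : ℝ => φ (x + t • v)) (φ v) 0 := by
      have hline : HasDerivAt (fun t : ℝ => x + t • v) v 0 := by
        simpa using ((hasDerivAt_id (0 : ℝ)).smul_const v).const_add x
      exact φ.hasFDerivAt.comp_hasDerivAt (0 : ℝ) hline
    have hgd : HasFDerivAt g (fderiv ℝ g (φ x).1) (φ (x + (0 : ℝ) • v)).1 := by
      simpa using (hg.differentiable (by simp)).differentiableAt.hasFDerivAt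
    have hfst : HasDerivAt (fun t : ℝ => (φ (x + t • v)).1) (φ v).1 0 :=
      (ContinuousLinearMap.fst ℝ (Fin m → ℝ) (Fin k → ℝ)).hasFDerivAt.comp_hasDerivAt
        (0 : ℝ) hc
    have hsnd : HasDerivAt (fun t : ℝ => (φ (x + t • v)).2) (φ v).2 0 :=
      (ContinuousLinearMap.snd ℝ (Fin m → ℝ) (Fin k → ℝ)).hasFDerivAt.comp_hasDerivAt
        (0 : ℝ) hc
    have hcomp := hgd.comp_hasDerivAt (0 : ℝ) hfst
    refine HasDerivAt.unique hsnd (hcomp.congr_of_eventuallyEq ?_)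
    have hcont : Filter.Tendsto (fun t : ℝ => x + t • v) (𝓝 0) (𝓝 x) := by
      have : Continuous fun t : ℝ => x + t • v := by fun_prop
      simpa using this.tendsto 0
    filter_upwards [hcont hU] with t ht
    exact (hUS _ ht).1 (hv t)
  have all : ∀ w : E, (φ w).2 = fderiv ℝ g (φ x).1 (φ w).1 := by
    intro w
    obtain ⟨v, v', rfl, hv, hv'⟩ := hlines w
    simp [tangent v hv, tangent v' hv']
  have zero : ∀ c : Fin k → ℝ, c = 0 := fun c => by simpa using all (φ.symm (0, c))
  filter_upwards [hU] with y hy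
  rw [hUS y hy, zero (φ y).2, zero (g _)]

/-- The fiber product of at least two nodal hypersurfaces is singular at the common node. -/
theorem not_isSmoothSubmanifoldAt_fiberProduct {l : ℕ} (hl : 2 ≤ l) {s : Fin l → ℕ}
    (hs : ∀ i, 1 ≤ s i) (q₀ : ℂ × ℂ) :
    ¬ IsSmoothSubmanifoldAt (((i : Fin l) → (Fin (s i + 1) → ℂ)) × (ℂ × ℂ))
        {x | ∀ i j : Fin l, x.1 i 0 * x.1 i 1 = x.1 j 0 * x.1 j 1}
        ((fun _ _ => 0), q₀) := by
  intro hS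
  have h10 : ∀ i, (1 : Fin (s i + 1)) ≠ 0 := fun i => by
    have := hs i
    rw [Ne, Fin.one_eq_zero_iff]
    omega
  have hnhds := hS.mem_nhds_of_lines fun w => by
    refine ⟨(fun i => Function.update (w.1 i) 1 0, w.2),
      (fun i => Pi.single 1 (w.1 i 1), 0), ?_, fun t i j => ?_, fun t i j => ?_⟩
    · refine Prod.ext (funext fun i => funext fun a => ?_) (by simp)
      by_cases ha : a = 1
      · subst ha; simp
      · simp [ha]
    · simp
    · simp [(h10 _).symm]
  let i₀ : Fin l := ⟨0, by omega⟩
  let i₁ : Fin l := ⟨1, by omega⟩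
  have hi : i₁ ≠ i₀ := by simp [i₀, i₁]
  let c : ℝ → ((i : Fin l) → (Fin (s i + 1) → ℂ)) × (ℂ × ℂ) := fun t =>
    (t • Pi.single i₀ (fun _ => (1 : ℂ)), q₀)
  have hc : Filter.Tendsto c (𝓝 0) (𝓝 ((fun _ _ => 0), q₀)) := by
    have hcont : Continuous c := by fun_prop
    have h0 : c 0 = ((fun _ _ => 0), q₀) := Prod.ext (zero_smul ℝ _) rfl
    exact h0 ▸ hcont.tendsto 0
  obtain ⟨t, ht, ht0⟩ := (((hc.eventually hnhds).filter_mono nhdsWithin_le_nhds).and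
    (self_mem_nhdsWithin (a := (0 : ℝ)) (s := {0}ᶜ))).exists
  have := ht i₀ i₁
  simp [c, hi] at this
  exact ht0 this

/-- The augmented fiber product is a smooth submanifold wherever every `h i` is a submersion. -/
theorem isSmoothSubmanifoldAt_augmented {l : ℕ} {s : Fin (l + 1) → ℕ}
    {h : Fin l → (ℂ × ℂ) → ℂ} (hh : ∀ i, ContDiff ℂ ω (h i))
    {x : ((i : Fin (l + 1)) → (Fin (s i + 1) → ℂ)) × (Fin l → ℂ × ℂ)}
    (hx : ∀ i : Fin l, x.1 0 0 * x.1 0 1 = x.1 i.succ 0 * x.1 i.succ 1 + h i (x.2 i))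
    (hsub : ∀ i, fderiv ℂ (h i) (x.2 i) ≠ 0) :
    IsSmoothSubmanifoldAt (((i : Fin (l + 1)) → (Fin (s i + 1) → ℂ)) × (Fin l → ℂ × ℂ))
      {x | ∀ i : Fin l, x.1 0 0 * x.1 0 1 = x.1 i.succ 0 * x.1 i.succ 1 + h i (x.2 i)} x := by
  let F : ((i : Fin (l + 1)) → (Fin (s i + 1) → ℂ)) × (Fin l → ℂ × ℂ) → Fin l → ℂ :=
    fun y i => y.1 i.succ 0 * y.1 i.succ 1 + h i (y.2 i) - y.1 0 0 * y.1 0 1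
  have hset : {x : ((i : Fin (l + 1)) → (Fin (s i + 1) → ℂ)) × (Fin l → ℂ × ℂ) |
      ∀ i : Fin l, x.1 0 0 * x.1 0 1 = x.1 i.succ 0 * x.1 i.succ 1 + h i (x.2 i)} =
      {y | F y = 0} := by
    ext y
    simp only [Set.mem_ofPred_eq, funext_iff, F, Pi.zero_apply, sub_eq_zero]
    exact forall_congr' fun i => eq_comm
  have hF : ContDiff ℝ ω F := by
    refine contDiff_pi.2 fun i => ?_
    have := (hh i).restrict_scalars ℝ
    have hz : ∀ j a, ContDiff ℝ ω
        fun y : ((i : Fin (l + 1)) → (Fin (s i + 1) → ℂ)) × (Fin l → ℂ × ℂ) => y.1 j a := by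
      intro j a
      exact contDiff_pi.1 (contDiff_pi.1 contDiff_fst j) a
    have hq : ContDiff ℝ ω
        fun y : ((i : Fin (l + 1)) → (Fin (s i + 1) → ℂ)) × (Fin l → ℂ × ℂ) => h i (y.2 i) := by
      fun_prop
    exact (((hz _ _).mul (hz _ _)).add hq).sub ((hz _ _).mul (hz _ _))
  rw [hset]
  refine isSmoothSubmanifoldAt_zeroSet hF.contDiffAt (hset.subset hx) fun c => ?_
  have hex : ∀ i, ∃ v, fderiv ℂ (h i) (x.2 i) v = c i := fun i =>
    LinearMap.surjective (f := (fderiv ℂ (h i) (x.2 i) : ℂ × ℂ →ₗ[ℂ] ℂ))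
      (fun h0 => hsub i (ContinuousLinearMap.coe_injective h0)) (c i)
  choose v hv using hex
  refine ⟨(0, v), ?_⟩
  have hFd : HasFDerivAt F (fderiv ℝ F x) (x.1, x.2) :=
    (hF.differentiable (by simp)).differentiableAt.hasFDerivAt
  have h₁ := hFd.comp x.2 (hasFDerivAt_prodMk_right (𝕜 := ℝ) x.1 x.2)
  have h₂ : HasFDerivAt (fun q : Fin l → ℂ × ℂ => F (x.1, q))
      (ContinuousLinearMap.pi fun i => ((fderiv ℂ (h i) (x.2 i)).restrictScalars ℝ).comp
        (ContinuousLinearMap.proj i)) x.2 := by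
    refine hasFDerivAt_pi.2 fun i => ?_
    have hd : HasFDerivAt (h i) ((fderiv ℂ (h i) (x.2 i)).restrictScalars ℝ) (x.2 i) :=
      (((hh i).differentiable (by simp)).differentiableAt.hasFDerivAt).restrictScalars ℝ
    have hi := HasFDerivAt.comp x.2 hd (f := fun q : Fin l → ℂ × ℂ => q i)
      (hasFDerivAt_apply i x.2)
    exact (hi.const_add (x.1 i.succ 0 * x.1 i.succ 1)).sub_const (x.1 0 0 * x.1 0 1)
  have := DFunLike.congr_fun (h₁.unique h₂) v
  ext i
  simpa [hv] using congrFun this i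

/-- The fiber-product model
`Z = {(z⁽¹⁾,…,z⁽ˡ⁾,q) : z⁽ⁱ⁾₁z⁽ⁱ⁾₂ = z⁽ʲ⁾₁z⁽ʲ⁾₂ ∀ i,j}` is singular at any point where all
`z⁽ⁱ⁾₁ = z⁽ⁱ⁾₂ = 0` (when `l ≥ 2`), but the augmented model
`Z̃ = {(z⁽⁰⁾,…,z⁽ˡ⁾,q₁,…,q_l) : z⁽⁰⁾₁z⁽⁰⁾₂ = z⁽ⁱ⁾₁z⁽ⁱ⁾₂ + hᵢ(qᵢ) ∀ i}`, where each `hᵢ` is a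
submersion at the base point `pᵢ`, is a smooth manifold at every point with `qᵢ = pᵢ`. -/
theorem stmt_19 (l : ℕ) (hl : 2 ≤ l) (s : Fin l → ℕ) (hs : ∀ i, 1 ≤ s i)
    (q0 : ℂ × ℂ)
    (s' : Fin (l + 1) → ℕ) (hs' : ∀ i, 1 ≤ s' i)
    (h : Fin l → (ℂ × ℂ) → ℂ) (p : Fin l → ℂ × ℂ)
    (hsmooth : ∀ i, ContDiff ℂ ⊤ (h i))
    (hsubmersion : ∀ i, fderiv ℂ (h i) (p i) ≠ 0) :
    ¬ IsSmoothSubmanifoldAt (((i : Fin l) → (Fin (s i + 1) → ℂ)) × (ℂ × ℂ))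
        {x | ∀ i j : Fin l, x.1 i 0 * x.1 i 1 = x.1 j 0 * x.1 j 1}
        ((fun _ _ => 0), q0)
      ∧ ∀ x : ((i : Fin (l + 1)) → (Fin (s' i + 1) → ℂ)) × (Fin l → ℂ × ℂ),
          (∀ i : Fin l, x.1 0 0 * x.1 0 1 = x.1 i.succ 0 * x.1 i.succ 1 + h i (x.2 i)) →
          (∀ i : Fin l, x.2 i = p i) →
          IsSmoothSubmanifoldAt (((i : Fin (l + 1)) → (Fin (s' i + 1) → ℂ)) × (Fin l → ℂ × ℂ))
            {x | ∀ i : Fin l, x.1 0 0 * x.1 0 1 = x.1 i.succ 0 * x.1 i.succ 1 + h i (x.2 i)}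
            x := by
  refine ⟨not_isSmoothSubmanifoldAt_fiberProduct hl hs q0, fun x hx hxp => ?_⟩
  exact isSmoothSubmanifoldAt_augmented hsmooth hx fun i => hxp i ▸ hsubmersion i
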